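/- arXiv:1410.4109 — 2 statements merged into one kernel-verified Lean document; each statement's English description precedes it below -/
import Mathlib

section
/- For every integer n ≥ 2, g_n = Σ_{j=1}^{n-1} b_{n,j}·(q−1)^{j-1}·g_{n-j} in ℤ[q], where b_{n,j} = Σ_{k=0}^{n-1-j} ((n−1+j−k)/j)·C(j+k−2, j−2)·C(n−2−k, j−1)·q^k, with the convention that the binomial coefficient C(m, −1) equals 1 if m = −1 and 0 otherwise (so that b_{n,1} = n). -/
open Finset Polynomial

/-- The cycle of `π` starting at `m`: `m, π m, π² m, …` through one full period. -/
noncomputable def cycleList {n : ℕ} (π : Equiv.Perm (Fin n)) (m : Fin n) : List (Fin n) :=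
  (List.range (Function.minimalPeriod π m)).map (fun k => (π ^ k) m)

/-- The minima of the cycles of `π`, listed in increasing order. -/
def cycleMins {n : ℕ} (π : Equiv.Perm (Fin n)) : List (Fin n) :=
  (Finset.univ.filter (fun m : Fin n => ∀ k < n, m ≤ (π ^ k) m)).sort (· ≤ ·)

/-- The flattened permutation of `π`, as a word on the letters `1, …, n`:
erase the parentheses from the standard cycle form of `π`. -/
noncomputable def flattenPerm {n : ℕ} (π : Equiv.Perm (Fin n)) : List ℕ :=
  ((cycleMins π).map (cycleList π)).flatten.map (fun m => (m : ℕ) + 1)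

/-- The number of occurrences of the pattern 13-2 in the word `w = w₁w₂⋯wₙ`
(1-based), i.e. the number of pairs `(i,j)` with `2 ≤ i < j ≤ n` and
`w_{i-1} < w_j < w_i`.  Below, `p.1` and `p.2` are the 0-based versions of `i` and `j`. -/
def occ (w : List ℕ) : ℕ :=
  ((Finset.range w.length ×ˢ Finset.range w.length).filter
    (fun p : ℕ × ℕ => 1 ≤ p.1 ∧ p.1 < p.2 ∧
      w.getD (p.1 - 1) 0 < w.getD p.2 0 ∧ w.getD p.2 0 < w.getD p.1 0)).card

/-- `g_n = Σ_{π ∈ S_n} q^{occ(Flatten(π))} ∈ ℤ[q]`. -/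
noncomputable def gPoly (n : ℕ) : Polynomial ℤ :=
  ∑ π : Equiv.Perm (Fin n), X ^ occ (flattenPerm π)

/-- `g_n(a₁⋯a_k)`: the sum of `q^{occ(Flatten(π))}` over the permutations `π` of length `n`
whose flattened permutation starts with the subword `a₁⋯a_k`. -/
noncomputable def gPrefix (n : ℕ) (w : List ℕ) : Polynomial ℤ :=
  ∑ π ∈ Finset.univ.filter (fun π : Equiv.Perm (Fin n) => w <+: flattenPerm π),
    X ^ occ (flattenPerm π)

/-- `g_{n,r}(a₁⋯a_k)`: the number of permutations `π` of length `n` such that `Flatten(π)`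
starts with `a₁⋯a_k` and has exactly `r` occurrences of the pattern 13-2. -/
noncomputable def gCount (n r : ℕ) (w : List ℕ) : ℕ :=
  (Finset.univ.filter (fun π : Equiv.Perm (Fin n) =>
    w <+: flattenPerm π ∧ occ (flattenPerm π) = r)).card

/-- Binomial coefficient `C(m, b)` for integer arguments, with the convention that
`C(m, -1) = 1` if `m = -1` and `0` otherwise, and `C(m, b) = 0` for `b < -1`. -/
def C' (m b : ℤ) : ℚ :=
  if b = -1 then (if m = -1 then 1 else 0)
  else if 0 ≤ b ∧ 0 ≤ m then (m.toNat.choose b.toNat : ℚ) else 0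

/-- The polynomial `b_{n,j} = Σ_{k=0}^{n-1-j} ((n−1+j−k)/j)·C(j+k−2,j−2)·C(n−2−k,j−1)·q^k`. -/
noncomputable def bPoly (n j : ℕ) : Polynomial ℚ :=
  ∑ k ∈ Finset.range (n - j),
    Polynomial.C (((n : ℚ) - 1 + j - k) / j * C' ((j : ℤ) + k - 2) ((j : ℤ) - 2)
        * C' ((n : ℤ) - 2 - k) ((j : ℤ) - 1)) * X ^ k


/-- weights `2` for rank zero, `1` otherwise -/
def eW {R : Type*} [CommRing R] (b : ℕ) : R := if b = 0 then 2 else 1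

/-- sum over cut words of an `m`-element set, with `p` letters below the previous letter -/
def FF {R : Type*} [CommRing R] (q : R) : ℕ → ℕ → R
  | 0, _ => 1
  | m + 1, p => ∑ b ∈ Finset.range (m + 1), eW b * q ^ (b - p) * FF q m b

/-- tail sums, size `M+1` -/
def PP {R : Type*} [CommRing R] (q : R) (a M : ℕ) : R :=
  ∑ b ∈ Finset.Ico a (M + 1), eW b * q ^ b * FF q M b

lemma PP_zero {R : Type*} [CommRing R] (q : R) (M : ℕ) : PP q 0 M = FF q (M + 1) 0 := by
  rw [PP, FF, Finset.range_eq_Ico]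
  rfl

lemma PP_step {R : Type*} [CommRing R] (q : R) (a M : ℕ) (h : a ≤ M) :
    PP q a M = eW a * q ^ a * FF q M a + PP q (a + 1) M := by
  unfold PP
  rw [Finset.sum_eq_sum_Ico_succ_bot (by omega)]

lemma PP_top {R : Type*} [CommRing R] (q : R) (M : ℕ) : PP q (M + 1) M = 0 := by
  simp [PP]

lemma FF_diff {R : Type*} [CommRing R] (q : R) (a M : ℕ) :
    q ^ (a + 1) * FF q (M + 1) (a + 1) = q * (q ^ a * FF q (M + 1) a)
      + (1 - q) * PP q (a + 1) M := by
  have hP : PP q (a + 1) M = ∑ b ∈ Finset.range (M + 1),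
      if a + 1 ≤ b then eW b * q ^ b * FF q M b else 0 := by
    unfold PP
    rw [← Finset.sum_filter]
    apply Finset.sum_congr _ (fun _ _ => rfl)
    ext b
    simp only [Finset.mem_Ico, Finset.mem_filter, Finset.mem_range]
    omega
  rw [hP, FF, FF, Finset.mul_sum, Finset.mul_sum, Finset.mul_sum, Finset.mul_sum,
    ← Finset.sum_add_distrib]
  apply Finset.sum_congr rfl
  intro b _
  by_cases hb : a + 1 ≤ b
  · obtain ⟨c, rfl⟩ := Nat.exists_eq_add_of_le hb
    have h1 : a + 1 + c - (a + 1) = c := by omega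
    have h2 : a + 1 + c - a = c + 1 := by omega
    rw [h1, h2, if_pos hb]
    ring
  · have h1 : b - (a + 1) = 0 := by omega
    have h2 : b - a = 0 := by omega
    rw [h1, h2, if_neg hb]
    ring

/-- the abstract recurrence -/
lemma PP_formula {R : Type*} [CommRing R] (q : R) (b : ℕ → ℕ → R)
    (hb1 : ∀ n, 2 ≤ n → b n 1 = n)
    (hb22 : b 3 2 = 2)
    (hbz : ∀ n j, n ≤ j → b n j = 0)
    (hbr : ∀ n j, 2 ≤ n → 2 ≤ j →
      b (n + 2) j = (1 + q) * b (n + 1) j + b (n + 1) (j - 1) - q * b n j)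
    (a : ℕ) : (∀ M, a ≤ M → PP q (a + 1) M = FF q (M + 1) 0 -
      ∑ j ∈ Finset.range (a + 1), b (a + 2) (j + 1) * (q - 1) ^ j * FF q (M - j) 0) ∧
      (∀ M, a + 1 ≤ M → PP q (a + 2) M = FF q (M + 1) 0 -
      ∑ j ∈ Finset.range (a + 2), b (a + 3) (j + 1) * (q - 1) ^ j * FF q (M - j) 0) := by
  induction a with
  | zero =>
    have base : ∀ M, PP q 1 M = FF q (M + 1) 0 - 2 * FF q M 0 := by
      intro M
      rw [← PP_zero, PP_step q 0 M (by omega)]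
      simp [eW]
    constructor
    · intro M _
      rw [base]
      simp [hb1]
    · intro M hM
      obtain ⟨M, rfl⟩ := Nat.exists_eq_add_of_le' hM
      have h1 := PP_step q 1 (M + 1) (by omega)
      have h2 := FF_diff q 0 M
      rw [base] at h1
      rw [base] at h2
      simp only [Finset.sum_range_succ, Finset.sum_range_zero]
      have h3 : (eW 1 : R) = 1 := by simp [eW]
      rw [h3] at h1
      norm_num [hb1, hb22] at h1 h2 ⊢
      linear_combination (-1 : R) * h1 - h2
  | succ a ih =>
    obtain ⟨ih1, ih2⟩ := ih
    refine ⟨ih2, ?_⟩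
    intro M hM
    obtain ⟨M, rfl⟩ := Nat.exists_eq_add_of_le' (show 1 ≤ M by omega)
    have s1 := PP_step q (a + 1) (M + 1) (by omega)
    have s2 := PP_step q (a + 2) (M + 1) (by omega)
    have d := FF_diff q (a + 1) M
    have e1 : (eW (a + 1) : R) = 1 := by simp [eW]
    have e2 : (eW (a + 2) : R) = 1 := by simp [eW]
    rw [e1] at s1
    rw [e2] at s2
    have key : PP q (a + 3) (M + 1) = (1 + q) * PP q (a + 2) (M + 1)
        + (q - 1) * PP q (a + 2) M - q * PP q (a + 1) (M + 1) := by
      linear_combination (q : R) * s1 - s2 - d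
    have i1 := ih1 (M + 1) (by omega)
    have i2 := ih2 (M + 1) (by omega)
    have i3 := ih2 M (by omega)
    show PP q (a + 3) (M + 1) = _
    rw [key, i1, i2, i3]
    -- extend the sums
    have x1 : ∑ j ∈ Finset.range (a + 1), b (a + 2) (j + 1) * (q - 1) ^ j * FF q (M + 1 - j) 0
        = ∑ j ∈ Finset.range (a + 3), b (a + 2) (j + 1) * (q - 1) ^ j * FF q (M + 1 - j) 0 := by
      rw [Finset.sum_range_succ _ (a + 2), Finset.sum_range_succ _ (a + 1),
        hbz (a + 2) (a + 2 + 1) (by omega), hbz (a + 2) (a + 1 + 1) (by omega)]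
      ring
    have x2 : ∑ j ∈ Finset.range (a + 2), b (a + 3) (j + 1) * (q - 1) ^ j * FF q (M + 1 - j) 0
        = ∑ j ∈ Finset.range (a + 3), b (a + 3) (j + 1) * (q - 1) ^ j * FF q (M + 1 - j) 0 := by
      rw [Finset.sum_range_succ _ (a + 2), 
        hbz (a + 3) (a + 2 + 1) (by omega)]
      ring
    rw [x1, x2, Finset.sum_range_succ' _ (a + 2), Finset.sum_range_succ' _ (a + 2),
      Finset.sum_range_succ' _ (a + 1 + 1)]
    have x3 : ∑ k ∈ Finset.range (a + 1 + 1),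
          b (a + 1 + 3) (k + 1 + 1) * (q - 1) ^ (k + 1) * FF q (M + 1 - (k + 1)) 0
        = (1 + q) * ∑ k ∈ Finset.range (a + 2),
          b (a + 3) (k + 1 + 1) * (q - 1) ^ (k + 1) * FF q (M + 1 - (k + 1)) 0
        + (q - 1) * ∑ k ∈ Finset.range (a + 2),
          b (a + 3) (k + 1) * (q - 1) ^ k * FF q (M - k) 0
        - q * ∑ k ∈ Finset.range (a + 2),
          b (a + 2) (k + 1 + 1) * (q - 1) ^ (k + 1) * FF q (M + 1 - (k + 1)) 0 := by
      rw [Finset.mul_sum, Finset.mul_sum, Finset.mul_sum, ← Finset.sum_add_distrib,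
        ← Finset.sum_sub_distrib]
      apply Finset.sum_congr rfl
      intro k _
      have := hbr (a + 2) (k + 1 + 1) (by omega) (by omega)
      have h4 : M + 1 - (k + 1) = M - k := by omega
      have h5 : k + 1 + 1 - 1 = k + 1 := by omega
      rw [h5] at this
      rw [h4]
      rw [show a + 1 + 3 = a + 2 + 2 by ring, this]
      ring
    rw [x3]
    have y1 := hb1 (a + 1 + 3) (by omega)
    have y2 := hb1 (a + 3) (by omega)
    have y3 := hb1 (a + 2) (by omega)
    push_cast at y1 y2 y3
    simp only [zero_add, pow_zero, y1, y2, y3, mul_one, Nat.sub_zero]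
    ring

lemma bPoly_coeff_raw (n j k : ℕ) : (bPoly n j).coeff k = if k < n - j then
    (((n : ℚ) - 1 + j - k) / j * C' ((j : ℤ) + k - 2) ((j : ℤ) - 2)
        * C' ((n : ℤ) - 2 - k) ((j : ℤ) - 1)) else 0 := by
  unfold bPoly
  simp only [Polynomial.finsetSum_coeff, Polynomial.coeff_C_mul, Polynomial.coeff_X_pow]
  simp only [mul_ite, mul_one, mul_zero, Finset.sum_ite_eq, Finset.mem_range]

lemma bPoly_zero (n j : ℕ) (h : n ≤ j) : bPoly n j = 0 := by
  unfold bPoly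
  rw [Nat.sub_eq_zero_of_le h]
  simp

lemma bPoly_one_coeff (n k : ℕ) (h : 2 ≤ n) : (bPoly n 1).coeff k = if k = 0 then (n : ℚ) else 0 := by
  rw [bPoly_coeff_raw]
  obtain ⟨n, rfl⟩ := Nat.exists_eq_add_of_le' h
  rcases k with _ | k
  · simp [C']
  · rw [if_neg (by omega : ¬ (k + 1 = 0))]
    have : C' (((1 : ℕ) : ℤ) + ((k + 1 : ℕ) : ℤ) - 2) (((1 : ℕ) : ℤ) - 2) = 0 := by
      unfold C'
      rw [if_pos (by norm_num), if_neg (by push_cast; omega)]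
    rw [this]
    simp

lemma bPoly_one (n : ℕ) (h : 2 ≤ n) : bPoly n 1 = n := by
  ext k
  rw [bPoly_one_coeff n k h, Polynomial.coeff_natCast_ite]
  split_ifs <;> simp

lemma bPoly_coeff (n j k : ℕ) (h : 2 ≤ n) : (bPoly n (j + 2)).coeff k =
    (((j + k).choose j : ℕ) : ℚ) *
      ((((n - 1 - k).choose (j + 2) : ℕ) : ℚ) + (((n - 2 - k).choose (j + 1) : ℕ) : ℚ)) := by
  rw [bPoly_coeff_raw]
  split_ifs with hk
  · obtain ⟨m, hm⟩ : ∃ m, n = m + k + 2 := ⟨n - k - 2, by omega⟩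
    subst hm
    have c1 : C' (((j + 2 : ℕ) : ℤ) + k - 2) (((j + 2 : ℕ) : ℤ) - 2) = (j + k).choose j := by
      have t1 : ((j + 2 : ℕ) : ℤ) + k - 2 = ((j + k : ℕ) : ℤ) := by push_cast; ring
      have t2 : ((j + 2 : ℕ) : ℤ) - 2 = ((j : ℕ) : ℤ) := by push_cast; ring
      rw [t1, t2]
      unfold C'
      rw [if_neg (by omega), if_pos (by omega), Int.toNat_natCast, Int.toNat_natCast]
    have c2 : C' (((m + k + 2 : ℕ) : ℤ) - 2 - k) (((j + 2 : ℕ) : ℤ) - 1) = m.choose (j + 1) := by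
      have t1 : ((m + k + 2 : ℕ) : ℤ) - 2 - k = ((m : ℕ) : ℤ) := by push_cast; ring
      have t2 : ((j + 2 : ℕ) : ℤ) - 1 = ((j + 1 : ℕ) : ℤ) := by push_cast; ring
      rw [t1, t2]
      unfold C'
      rw [if_neg (by omega), if_pos (by omega)]
      simp
    rw [c1, c2]
    have t3 : m + k + 2 - 1 - k = m + 1 := by omega
    have t4 : m + k + 2 - 2 - k = m := by omega
    rw [t3, t4]
    have := Nat.add_one_mul_choose_eq m (j + 1)
    have h' : ((m : ℚ) + 1) * (m.choose (j + 1) : ℕ) = ((m + 1).choose (j + 2) : ℕ) * (j + 2) := by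
      have := congrArg (Nat.cast : ℕ → ℚ) this
      push_cast at this
      rw [this]; ring
    have hj : ((j : ℚ) + 2) ≠ 0 := by positivity
    push_cast
    field_simp
    linear_combination (((j + k).choose j : ℕ) : ℚ) * h'
  · rw [Nat.choose_eq_zero_of_lt (by omega : n - 1 - k < j + 2),
      Nat.choose_eq_zero_of_lt (by omega : n - 2 - k < j + 1)]
    simp

lemma bPoly_rec (n j : ℕ) (hn : 2 ≤ n) (hj : 2 ≤ j) : bPoly (n + 2) j =
    (1 + X) * bPoly (n + 1) j + bPoly (n + 1) (j - 1) - X * bPoly n j := by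
  obtain ⟨j, rfl⟩ := Nat.exists_eq_add_of_le' hj
  obtain ⟨n, rfl⟩ := Nat.exists_eq_add_of_le' hn
  ext k
  rw [add_mul, one_mul]
  simp only [Polynomial.coeff_add, Polynomial.coeff_sub]
  rw [show j + 2 - 1 = j + 1 by omega]
  have pas : ∀ m : ℕ, (((m + 2).choose (j + 2) : ℕ) : ℚ) + ((m + 1).choose (j + 1) : ℕ)
      = ((m + 1).choose (j + 2) : ℕ) + ((m + 1).choose (j + 1) : ℕ) + (m.choose (j + 1) : ℕ)
        + (m.choose j : ℕ) := by
    intro m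
    rw [Nat.choose_succ_succ (m + 1) (j + 1), Nat.choose_succ_succ m j]
    push_cast; ring
  have pas' : ∀ m : ℕ, (((m + 1).choose (j + 1) : ℕ) : ℚ)
      = (m.choose (j + 1) : ℕ) + (m.choose j : ℕ) := by
    intro m
    rw [Nat.choose_succ_succ m j]
    push_cast; ring
  have small : ∀ i, j = i + 1 → bPoly (n + 2 + 1) (j + 1) = bPoly (n + 2 + 1) (i + 2) := by
    rintro i rfl; rfl
  rcases k with _ | k
  · simp only [Polynomial.coeff_X_mul_zero]
    rw [bPoly_coeff _ _ _ (by omega), bPoly_coeff _ _ _ (by omega)]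
    rcases j with _ | i
    · rw [bPoly_one_coeff _ _ (by omega)]
      have := pas (n + 1)
      simp at this ⊢
      linarith
    · rw [small i rfl, bPoly_coeff _ _ _ (by omega)]
      have h1 := pas (n + 1)
      have h2 := pas' (n + 1)
      simp at h1 h2 ⊢
      linarith
  · simp only [Polynomial.coeff_X_mul]
    rw [bPoly_coeff _ _ _ (by omega), bPoly_coeff _ _ _ (by omega), bPoly_coeff _ _ _ (by omega),
      bPoly_coeff _ _ _ (by omega)]
    by_cases hk : k ≤ n
    · obtain ⟨m, rfl⟩ := Nat.exists_eq_add_of_le' hk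
      have e1 : m + k + 2 + 2 - 1 - (k + 1) = m + 2 := by omega
      have e2 : m + k + 2 + 2 - 2 - (k + 1) = m + 1 := by omega
      have e3 : m + k + 2 + 1 - 1 - (k + 1) = m + 1 := by omega
      have e4 : m + k + 2 + 1 - 2 - (k + 1) = m := by omega
      have e5 : m + k + 2 + 1 - 1 - k = m + 2 := by omega
      have e6 : m + k + 2 + 1 - 2 - k = m + 1 := by omega
      have e7 : m + k + 2 - 1 - k = m + 1 := by omega
      have e8 : m + k + 2 - 2 - k = m := by omega
      rw [e1, e2, e3, e4, e5, e6, e7, e8, pas m]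
      rcases j with _ | i
      · rw [bPoly_one_coeff _ _ (by omega)]
        simp
      · rw [small i rfl, bPoly_coeff _ _ _ (by omega), e3, e4]
        have pe : (((i + 1 + (k + 1)).choose (i + 1) : ℕ) : ℚ) =
          ((i + (k + 1)).choose i : ℕ) + ((i + 1 + k).choose (i + 1) : ℕ) := by
          rw [show i + 1 + (k + 1) = (i + 1 + k) + 1 by ring, Nat.choose_succ_succ,
            show i + 1 + k = i + (k + 1) by ring]
          push_cast; ring
        rw [pe]
        have h2 := pas' m
        rw [h2]
        ring
    · have e1 : n + 2 + 2 - 1 - (k + 1) ≤ 1 := by omega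
      rw [Nat.choose_eq_zero_of_lt (by omega : n + 2 + 2 - 1 - (k + 1) < j + 2),
        Nat.choose_eq_zero_of_lt (by omega : n + 2 + 2 - 2 - (k + 1) < j + 1),
        Nat.choose_eq_zero_of_lt (by omega : n + 2 + 1 - 1 - (k + 1) < j + 2),
        Nat.choose_eq_zero_of_lt (by omega : n + 2 + 1 - 2 - (k + 1) < j + 1),
        Nat.choose_eq_zero_of_lt (by omega : n + 2 + 1 - 1 - k < j + 2),
        Nat.choose_eq_zero_of_lt (by omega : n + 2 + 1 - 2 - k < j + 1),
        Nat.choose_eq_zero_of_lt (by omega : n + 2 - 1 - k < j + 2),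
        Nat.choose_eq_zero_of_lt (by omega : n + 2 - 2 - k < j + 1)]
      rcases j with _ | i
      · rw [bPoly_one_coeff _ _ (by omega)]
        simp
      · rw [small i rfl, bPoly_coeff _ _ _ (by omega),
          Nat.choose_eq_zero_of_lt (by omega : n + 2 + 1 - 1 - (k + 1) < i + 2),
          Nat.choose_eq_zero_of_lt (by omega : n + 2 + 1 - 2 - (k + 1) < i + 1)]
        simp

lemma bPoly_three_two : bPoly 3 2 = 2 := by
  ext k
  rw [bPoly_coeff 3 0 k (by omega), show (2 : ℚ[X]) = ((2 : ℕ) : ℚ[X]) by norm_num,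
    Polynomial.coeff_natCast_ite]
  rcases k with _ | k
  · norm_num [Nat.choose]
  · rw [Nat.choose_eq_zero_of_lt (by omega : 3 - 1 - (k + 1) < 0 + 2),
      Nat.choose_eq_zero_of_lt (by omega : 3 - 2 - (k + 1) < 0 + 1)]
    simp

lemma FF_recurrence (m : ℕ) (hm : 1 ≤ m) : FF (X : ℚ[X]) m 0 =
    ∑ j ∈ Finset.range m, bPoly (m + 1) (j + 1) * (X - 1) ^ j * FF (X : ℚ[X]) (m - 1 - j) 0 := by
  obtain ⟨a, rfl⟩ := Nat.exists_eq_add_of_le' hm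
  have := (PP_formula (X : ℚ[X]) bPoly bPoly_one bPoly_three_two bPoly_zero bPoly_rec a).1 a le_rfl
  rw [PP_top] at this
  exact (sub_eq_zero.mp this.symm)

/-- recursive version of `occ` on the word `x :: l` -/
def wt : ℕ → List ℕ → ℕ
  | _, [] => 0
  | x, y :: l => l.countP (fun z => decide (x < z ∧ z < y)) + wt y l

lemma occ_eq_sum (w : List ℕ) : occ w = ∑ i ∈ Finset.range w.length, ∑ j ∈ Finset.range w.length,
    if 1 ≤ i ∧ i < j ∧ w.getD (i - 1) 0 < w.getD j 0 ∧ w.getD j 0 < w.getD i 0 then 1 else 0 := by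
  unfold occ
  rw [Finset.card_filter, Finset.sum_product]

lemma countP_eq_sum (l : List ℕ) (p : ℕ → Prop) [DecidablePred p] :
    l.countP (fun z => decide (p z)) = ∑ j ∈ Finset.range l.length, if p (l.getD j 0) then 1 else 0 := by
  induction l with
  | nil => simp
  | cons a l ih =>
    rw [List.length_cons, Finset.sum_range_succ', List.countP_cons, ih]
    simp

lemma occ_eq_wt (x : ℕ) (l : List ℕ) : occ (x :: l) = wt x l := by
  induction l generalizing x with
  | nil => simp [occ_eq_sum, wt]
  | cons y l ih =>
    rw [wt, ← ih y, occ_eq_sum, occ_eq_sum, countP_eq_sum]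
    simp only [List.length_cons]
    rw [Finset.sum_range_succ' _ (l.length + 1)]
    simp only [Finset.sum_range_succ' _ (l.length + 1)]
    rw [Finset.sum_range_succ' (fun k => _ + _) (l.length)]
    rw [Finset.sum_range_succ' (fun k => ∑ j ∈ Finset.range (l.length + 1), _) (l.length)]
    simp only [Finset.sum_range_succ' _ (l.length)]
    simp
    rw [add_comm]

/-- admissible flags -/
def flags (S : Finset ℕ) (y : ℕ) : Finset Bool :=
  if ∀ s ∈ S, y ≤ s then {true, false} else {false}

/-- cut words on the letter set `S` -/
def cw : ℕ → Finset ℕ → Finset (List (ℕ × Bool))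
  | 0, _ => {[]}
  | m + 1, S => (S.sigma (fun y => flags S y ×ˢ cw m (S.erase y))).image
      (fun p => (p.1, p.2.1) :: p.2.2)

lemma sum_cw {R : Type*} [CommRing R] (m : ℕ) (S : Finset ℕ) (f : List (ℕ × Bool) → R) :
    ∑ l ∈ cw (m + 1) S, f l
      = ∑ y ∈ S, ∑ c ∈ flags S y, ∑ l ∈ cw m (S.erase y), f ((y, c) :: l) := by
  rw [cw, Finset.sum_image, Finset.sum_sigma]
  · apply Finset.sum_congr rfl
    intro y _
    rw [Finset.sum_product]
  · rintro ⟨a, b, c⟩ _ ⟨a', b', c'⟩ _ h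
    simp at h
    obtain ⟨⟨rfl, rfl⟩, rfl⟩ := h
    rfl

lemma cw_perm (m : ℕ) (S : Finset ℕ) (hS : S.card = m) (l : List (ℕ × Bool)) (hl : l ∈ cw m S) :
    (l.map Prod.fst).Nodup ∧ (l.map Prod.fst).toFinset = S := by
  induction m generalizing S l with
  | zero =>
    simp [cw] at hl
    subst hl
    simp [Finset.card_eq_zero.mp hS]
  | succ m ih =>
    simp only [cw, Finset.mem_image, Finset.mem_sigma, Finset.mem_product] at hl
    obtain ⟨⟨y, c, l'⟩, ⟨hy, hc, hl'⟩, rfl⟩ := hl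
    obtain ⟨h1, h2⟩ := ih (S.erase y) (by rw [Finset.card_erase_of_mem hy, hS]; rfl) l' hl'
    simp only [List.map_cons, List.nodup_cons, List.toFinset_cons]
    refine ⟨⟨?_, h1⟩, ?_⟩
    · rw [← List.mem_toFinset, h2]
      simp
    · rw [h2, Finset.insert_erase hy]

lemma mem_cw (m : ℕ) (S : Finset ℕ) (l : List (ℕ × Bool)) (hm : l.length = m)
    (hn : (l.map Prod.fst).Nodup) (hS : (l.map Prod.fst).toFinset = S)
    (hp : l.Pairwise (fun a b => a.2 = true → a.1 < b.1)) : l ∈ cw m S := by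
  induction m generalizing S l with
  | zero =>
    simp at hm
    simp [cw, hm]
  | succ m ih =>
    rcases l with _ | ⟨⟨y, c⟩, l⟩
    · simp at hm
    · simp only [List.map_cons, List.nodup_cons, List.toFinset_cons, List.pairwise_cons,
        List.length_cons] at hm hn hS hp
      simp only [cw, Finset.mem_image, Finset.mem_sigma, Finset.mem_product]
      refine ⟨⟨y, c, l⟩, ⟨?_, ?_, ?_⟩, rfl⟩
      · rw [← hS]; simp
      · unfold flags
        cases c
        · split_ifs <;> simp
        · rw [if_pos]
          · simp
          · intro s hs
            rw [← hS, Finset.mem_insert, List.mem_toFinset, List.mem_map] at hs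
            rcases hs with rfl | ⟨a, ha, rfl⟩
            · exact le_rfl
            · exact (hp.1 a ha rfl).le
      · apply ih _ _ (by omega) hn.2 _ hp.2
        rw [← hS, Finset.erase_insert]
        rw [List.mem_toFinset]
        exact hn.1

/-- number of letters of `S` below `x` -/
def rk (S : Finset ℕ) (x : ℕ) : ℕ := (S.filter (· < x)).card

lemma rk_lt (S : Finset ℕ) {x y : ℕ} (hx : x ∈ S) (h : x < y) : rk S x < rk S y := by
  apply Finset.card_lt_card
  rw [Finset.ssubset_iff_of_subset]
  · exact ⟨x, by simp [hx, h], by simp⟩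
  · intro z
    simp only [Finset.mem_filter]
    exact fun hz => ⟨hz.1, by omega⟩

lemma sum_rk {R : Type*} [CommRing R] (S : Finset ℕ) (f : ℕ → R) :
    ∑ y ∈ S, f (rk S y) = ∑ b ∈ Finset.range S.card, f b := by
  have hinj : Set.InjOn (rk S) S := by
    intro a ha b hb h
    rcases lt_trichotomy a b with h' | h' | h'
    · have := rk_lt S ha h'; omega
    · exact h'
    · have := rk_lt S hb h'; omega
  rw [← Finset.sum_image (f := f) hinj]
  congr 1
  apply Finset.eq_of_subset_of_card_le
  · intro b hb
    rw [Finset.mem_image] at hb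
    obtain ⟨y, hy, rfl⟩ := hb
    rw [Finset.mem_range]
    apply Finset.card_lt_card
    rw [Finset.ssubset_iff_of_subset (Finset.filter_subset _ _)]
    exact ⟨y, hy, by simp⟩
  · rw [Finset.card_image_of_injOn hinj, Finset.card_range]

lemma rk_zero_iff (S : Finset ℕ) (y : ℕ) : rk S y = 0 ↔ ∀ s ∈ S, y ≤ s := by
  unfold rk
  rw [Finset.card_eq_zero, Finset.filter_eq_empty_iff]
  simp

lemma countP_eq_rk (S : Finset ℕ) (x y : ℕ) (hx : x ∉ S) (l : List ℕ)
    (hn : l.Nodup) (hl : l.toFinset = S.erase y) :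
    l.countP (fun z => decide (x < z ∧ z < y)) = rk S y - rk S x := by
  have h1 : l.countP (fun z => decide (x < z ∧ z < y))
      = (S.filter (fun z => x < z ∧ z < y)).card := by
    rw [List.countP_eq_length_filter, ← List.toFinset_card_of_nodup (hn.filter _),
      List.toFinset_filter, hl]
    congr 1
    ext z
    simp
    intro h1 h2 _
    omega
  rw [h1]
  unfold rk
  rcases lt_or_ge x y with h | h
  · have : S.filter (· < y) = S.filter (· < x) ∪ S.filter (fun z => x < z ∧ z < y) := by
      ext z
      simp only [Finset.mem_filter, Finset.mem_union]
      constructor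
      · rintro ⟨hz, hzy⟩
        have : z ≠ x := fun h => hx (h ▸ hz)
        rcases lt_or_gt_of_ne this with h' | h'
        · exact Or.inl ⟨hz, h'⟩
        · exact Or.inr ⟨hz, h', hzy⟩
      · rintro (⟨hz, h'⟩ | ⟨hz, h', h''⟩)
        · exact ⟨hz, by omega⟩
        · exact ⟨hz, h''⟩
    rw [this, Finset.card_union_of_disjoint]
    · omega
    · rw [Finset.disjoint_left]
      intro z hz hz'
      simp only [Finset.mem_filter] at hz hz'
      omega
  · have e1 : (S.filter (fun z => x < z ∧ z < y)) = ∅ := by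
      rw [Finset.filter_eq_empty_iff]
      intro z _
      omega
    have e2 : (S.filter (· < y)).card ≤ (S.filter (· < x)).card := by
      apply Finset.card_le_card
      intro z
      simp only [Finset.mem_filter]
      exact fun hz => ⟨hz.1, by omega⟩
    rw [e1, Finset.card_empty]
    omega

lemma cw_sum {R : Type*} [CommRing R] (q : R) (m : ℕ) (S : Finset ℕ) (hS : S.card = m)
    (x : ℕ) (hx : x ∉ S) :
    ∑ l ∈ cw m S, q ^ wt x (l.map Prod.fst) = FF q m (rk S x) := by
  induction m generalizing S x with
  | zero => simp [cw, FF, wt]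
  | succ m ih =>
    rw [sum_cw, FF, ← hS, ← sum_rk]
    apply Finset.sum_congr rfl
    intro y hy
    have hc : (S.erase y).card = m := by rw [Finset.card_erase_of_mem hy, hS]; rfl
    have hr : rk (S.erase y) y = rk S y := by
      unfold rk
      congr 1
      ext z
      simp only [Finset.mem_filter, Finset.mem_erase]
      constructor
      · exact fun h => ⟨h.1.2, h.2⟩
      · exact fun h => ⟨⟨by omega, h.1⟩, h.2⟩
    have inner : ∀ c : Bool, ∑ l ∈ cw m (S.erase y), q ^ wt x (((y, c) :: l).map Prod.fst)
        = q ^ (rk S y - rk S x) * FF q m (rk S y) := by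
      intro c
      rw [← hr, ← ih (S.erase y) hc y (by simp), Finset.mul_sum]
      apply Finset.sum_congr rfl
      intro l hl
      obtain ⟨h1, h2⟩ := cw_perm m _ hc l hl
      rw [List.map_cons, wt, pow_add, countP_eq_rk S x y hx _ h1 h2, hr]
    rw [Finset.sum_congr rfl (fun c _ => inner c), Finset.sum_const]
    unfold flags eW
    simp only [rk_zero_iff]
    split_ifs
    · simp
      ring
    · simp

lemma FF_one (m p : ℕ) : FF (1 : ℤ) m p = ((m + 1).factorial : ℕ) := by
  induction m generalizing p with
  | zero => simp [FF]
  | succ m ih =>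
    rw [FF]
    simp only [ih, one_pow, mul_one]
    rw [← Finset.sum_mul, Finset.sum_range_succ']
    rw [Nat.factorial_succ (m + 1)]
    simp [eW]
    left
    ring

lemma cw_card (m : ℕ) (S : Finset ℕ) (hS : S.card = m) : (cw m S).card = (m + 1).factorial := by
  obtain ⟨x, hx⟩ := Infinite.exists_notMem_finset S
  have := cw_sum (1 : ℤ) m S hS x hx
  rw [FF_one] at this
  simp at this
  exact_mod_cast this

section perms
variable {n : ℕ}

lemma period_pos (π : Equiv.Perm (Fin n)) (m : Fin n) : 0 < Function.minimalPeriod π m := by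
  apply Function.minimalPeriod_pos_of_mem_periodicPts
  obtain ⟨k, hk, h⟩ := (isOfFinOrder_of_finite π).exists_pow_eq_one
  refine Function.mk_mem_periodicPts hk ?_
  rw [Function.IsPeriodicPt, Function.IsFixedPt, Equiv.Perm.iterate_eq_pow, h]
  rfl

lemma pow_mod_period (π : Equiv.Perm (Fin n)) (m : Fin n) (k : ℕ) :
    (π ^ (k % Function.minimalPeriod π m)) m = (π ^ k) m := by
  have := Function.iterate_mod_minimalPeriod_eq (f := π) (x := m) (n := k)
  rw [Equiv.Perm.iterate_eq_pow, Equiv.Perm.iterate_eq_pow] at this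
  exact this

lemma mem_cycleMins (π : Equiv.Perm (Fin n)) (m : Fin n) :
    m ∈ cycleMins π ↔ ∀ k : ℕ, m ≤ (π ^ k) m := by
  unfold cycleMins
  rw [Finset.mem_sort, Finset.mem_filter]
  constructor
  · rintro ⟨_, h⟩ k
    rw [← pow_mod_period]
    apply h
    have h1 := Nat.mod_lt k (period_pos π m)
    have h2 : Function.minimalPeriod π m ≤ Fintype.card (Fin n) := Function.minimalPeriod_le_card
    rw [Fintype.card_fin] at h2
    omega
  · intro h
    exact ⟨Finset.mem_univ _, fun k _ => h k⟩

lemma mem_cycleList (π : Equiv.Perm (Fin n)) (m x : Fin n) :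
    x ∈ cycleList π m ↔ ∃ k : ℕ, (π ^ k) m = x := by
  unfold cycleList
  rw [List.mem_map]
  constructor
  · rintro ⟨k, _, h⟩
    exact ⟨k, h⟩
  · rintro ⟨k, h⟩
    exact ⟨k % Function.minimalPeriod π m, List.mem_range.mpr (Nat.mod_lt _ (period_pos π m)),
      by rw [pow_mod_period, h]⟩

lemma mem_cycleList_self (π : Equiv.Perm (Fin n)) (m : Fin n) : m ∈ cycleList π m :=
  (mem_cycleList π m m).mpr ⟨0, rfl⟩

lemma cycleList_symm (π : Equiv.Perm (Fin n)) (m x : Fin n) (h : x ∈ cycleList π m) :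
    m ∈ cycleList π x := by
  unfold cycleList at h
  rw [List.mem_map] at h
  obtain ⟨k, hk, rfl⟩ := h
  rw [List.mem_range] at hk
  rw [mem_cycleList]
  refine ⟨Function.minimalPeriod π m - k, ?_⟩
  rw [← Equiv.Perm.mul_apply, ← pow_add, Nat.sub_add_cancel hk.le, ← pow_mod_period,
    Nat.mod_self]
  rfl

lemma cycleList_trans (π : Equiv.Perm (Fin n)) (a b c : Fin n) (h : b ∈ cycleList π a)
    (h' : c ∈ cycleList π b) : c ∈ cycleList π a := by
  rw [mem_cycleList] at *
  obtain ⟨k, rfl⟩ := h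
  obtain ⟨l, rfl⟩ := h'
  exact ⟨l + k, by rw [pow_add, Equiv.Perm.mul_apply]⟩

lemma mins_le (π : Equiv.Perm (Fin n)) (m x : Fin n) (hm : m ∈ cycleMins π)
    (h : x ∈ cycleList π m) : m ≤ x := by
  rw [mem_cycleMins] at hm
  rw [mem_cycleList] at h
  obtain ⟨k, rfl⟩ := h
  exact hm k

lemma mins_unique (π : Equiv.Perm (Fin n)) (m m' x : Fin n) (hm : m ∈ cycleMins π)
    (hm' : m' ∈ cycleMins π) (h : x ∈ cycleList π m) (h' : x ∈ cycleList π m') : m = m' := by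
  apply le_antisymm
  · exact mins_le π _ _ hm (cycleList_trans π m x m' h (cycleList_symm π _ _ h'))
  · exact mins_le π _ _ hm' (cycleList_trans π m' x m h' (cycleList_symm π _ _ h))

/-- the flattened word on `Fin n` -/
noncomputable def flat (π : Equiv.Perm (Fin n)) : List (Fin n) :=
  ((cycleMins π).map (cycleList π)).flatten

lemma mem_flat (π : Equiv.Perm (Fin n)) (x : Fin n) : x ∈ flat π := by
  have hne : (cycleList π x).toFinset.Nonempty :=
    ⟨x, List.mem_toFinset.mpr (mem_cycleList_self π x)⟩
  obtain ⟨m, hm, hmin⟩ := Finset.exists_min_image _ id hne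
  rw [List.mem_toFinset] at hm
  unfold flat
  rw [List.mem_flatten]
  refine ⟨cycleList π m, List.mem_map_of_mem ?_, cycleList_symm π _ _ hm⟩
  rw [mem_cycleMins]
  intro k
  apply hmin
  rw [List.mem_toFinset]
  exact cycleList_trans π x m _ hm ((mem_cycleList π _ _).mpr ⟨k, rfl⟩)

lemma cycleList_nodup (π : Equiv.Perm (Fin n)) (m : Fin n) : (cycleList π m).Nodup := by
  unfold cycleList
  apply List.Nodup.map_on _ List.nodup_range
  intro a ha b hb h
  rw [List.mem_range] at ha hb
  apply Function.iterate_injOn_Iio_minimalPeriod (f := π) (x := m) ha hb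
  simpa [Equiv.Perm.iterate_eq_pow] using h

lemma cycleList_eq_cons (π : Equiv.Perm (Fin n)) (m : Fin n) :
    ∃ t, cycleList π m = m :: t := by
  unfold cycleList
  obtain ⟨p, hp⟩ := Nat.exists_eq_add_of_lt (period_pos π m)
  rw [hp, zero_add, List.range_succ_eq_map]
  exact ⟨_, rfl⟩

lemma cycleMins_sorted (π : Equiv.Perm (Fin n)) : (cycleMins π).Pairwise (· < ·) := by
  unfold cycleMins
  exact (Finset.sortedLT_sort _).pairwise

lemma flat_pairwise (π : Equiv.Perm (Fin n)) :
    (flat π).Pairwise (fun x y => x ≠ y ∧ (x ∈ cycleMins π → x < y)) := by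
  unfold flat
  rw [List.pairwise_flatten]
  constructor
  · intro l hl
    rw [List.mem_map] at hl
    obtain ⟨m, hm, rfl⟩ := hl
    have h1 := cycleList_nodup π m
    have h2 : ∀ x ∈ cycleList π m, x ∈ cycleMins π → x = m := fun x hx hx' =>
      mins_unique π x m x hx' hm (mem_cycleList_self π x) hx
    have h3 : ∀ y ∈ cycleList π m, m ≤ y := fun y hy => mins_le π m y hm hy
    refine List.Pairwise.imp_of_mem ?_ h1
    intro a b ha hb hab
    refine ⟨hab, fun ha' => ?_⟩
    have := h2 a ha ha'
    subst this
    exact lt_of_le_of_ne (h3 b hb) hab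
  · rw [List.pairwise_map]
    refine List.Pairwise.imp_of_mem ?_ (cycleMins_sorted π)
    intro a b ha hb hab x hx y hy
    refine ⟨?_, fun hx' => ?_⟩
    · rintro rfl
      exact hab.ne (mins_unique π a b x ha hb hx hy)
    · have := mins_unique π x a x hx' ha (mem_cycleList_self π x) hx
      subst this
      exact lt_of_lt_of_le hab (mins_le π b y hb hy)

lemma split_unique {α : Type*} (P : α → Prop) (A B : List (List α))
    (hA : ∀ l ∈ A, ∃ a t, l = a :: t ∧ P a ∧ ∀ x ∈ t, ¬ P x)
    (hB : ∀ l ∈ B, ∃ a t, l = a :: t ∧ P a ∧ ∀ x ∈ t, ¬ P x)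
    (h : A.flatten = B.flatten) : A = B := by
  induction A generalizing B with
  | nil =>
    rcases B with _ | ⟨l, B⟩
    · rfl
    · obtain ⟨a, t, rfl, _⟩ := hB l (by simp)
      simp at h
  | cons l A ih =>
    obtain ⟨a, t, rfl, ha, ht⟩ := hA l (by simp)
    rcases B with _ | ⟨l', B⟩
    · simp at h
    · obtain ⟨b, s, rfl, hb, hs⟩ := hB l' (by simp)
      have hA' : ∀ l ∈ A, ∃ a t, l = a :: t ∧ P a ∧ ∀ x ∈ t, ¬ P x :=
        fun l hl => hA l (List.mem_cons_of_mem _ hl)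
      have hB' : ∀ l ∈ B, ∃ a t, l = a :: t ∧ P a ∧ ∀ x ∈ t, ¬ P x :=
        fun l hl => hB l (List.mem_cons_of_mem _ hl)
      have hd : ∀ (D : List (List α)), (∀ l ∈ D, ∃ a t, l = a :: t ∧ P a ∧ ∀ x ∈ t, ¬ P x) →
          ∀ c r, D.flatten = c :: r → P c := by
        intro D hD c r hc
        rcases D with _ | ⟨d, D⟩
        · simp at hc
        · obtain ⟨a, t, rfl, ha, _⟩ := hD d (by simp)
          simp at hc
          exact hc.1 ▸ ha
      simp only [List.flatten_cons, List.cons_append, List.cons.injEq] at h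
      obtain ⟨rfl, h⟩ := h
      rw [List.append_eq_append_iff] at h
      have : t = s ∧ A.flatten = B.flatten := by
        rcases h with ⟨c, h1, h2⟩ | ⟨c, h1, h2⟩
        · rcases c with _ | ⟨c, r⟩
          · simp at h1 h2
            exact ⟨h1.symm, h2⟩
          · exact absurd (hd A hA' c _ h2) (hs c (by rw [h1]; simp))
        · rcases c with _ | ⟨c, r⟩
          · simp at h1 h2
            exact ⟨h1, h2.symm⟩
          · exact absurd (hd B hB' c _ h2) (ht c (by rw [h1]; simp))
      obtain ⟨rfl, h'⟩ := this
      rw [ih B hA' hB' h']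

lemma blocks_spec (π : Equiv.Perm (Fin n)) : ∀ l ∈ (cycleMins π).map (cycleList π),
    ∃ a t, l = a :: t ∧ a ∈ cycleMins π ∧ ∀ x ∈ t, ¬ x ∈ cycleMins π := by
  intro l hl
  rw [List.mem_map] at hl
  obtain ⟨m, hm, rfl⟩ := hl
  obtain ⟨t, ht⟩ := cycleList_eq_cons π m
  refine ⟨m, t, ht, hm, ?_⟩
  intro x hx hx'
  have hn := cycleList_nodup π m
  have := mins_unique π x m x hx' hm (mem_cycleList_self π x) (by rw [ht]; simp [hx])
  subst this
  rw [ht, List.nodup_cons] at hn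
  exact hn.1 hx

lemma perm_eq_of (π σ : Equiv.Perm (Fin n)) (h1 : flat π = flat σ)
    (h2 : ∀ x, x ∈ cycleMins π ↔ x ∈ cycleMins σ) : π = σ := by
  have hb : (cycleMins π).map (cycleList π) = (cycleMins σ).map (cycleList σ) := by
    apply split_unique (fun x => x ∈ cycleMins π) _ _ (blocks_spec π) _ h1
    simp only [h2]
    exact blocks_spec σ
  ext1 x
  have hx := mem_flat π x
  unfold flat at hx
  rw [List.mem_flatten] at hx
  obtain ⟨l, hl, hx⟩ := hx
  have hl' := hl
  rw [hb] at hl'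
  rw [List.mem_map] at hl hl'
  obtain ⟨m, hm, rfl⟩ := hl
  obtain ⟨m', hm', he⟩ := hl'
  have hmm : m' = m := by
    obtain ⟨t, ht⟩ := cycleList_eq_cons π m
    obtain ⟨t', ht'⟩ := cycleList_eq_cons σ m'
    rw [ht, ht'] at he
    exact (List.cons.inj he).1
  subst hmm
  have hp : Function.minimalPeriod σ m' = Function.minimalPeriod π m' := by
    have := congrArg List.length he
    simpa [cycleList] using this
  have hk : ∀ k < Function.minimalPeriod π m', (σ ^ k) m' = (π ^ k) m' := by
    intro k hk
    unfold cycleList at he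
    rw [hp, List.map_inj_left] at he
    exact he k (List.mem_range.mpr hk)
  have hk' : ∀ k, (σ ^ k) m' = (π ^ k) m' := by
    intro k
    rw [← pow_mod_period π, ← pow_mod_period σ, hp]
    exact hk _ (Nat.mod_lt _ (period_pos π m'))
  rw [mem_cycleList] at hx
  obtain ⟨k, rfl⟩ := hx
  have e1 := hk' (k + 1)
  rw [pow_succ', pow_succ', Equiv.Perm.mul_apply, Equiv.Perm.mul_apply, hk' k] at e1
  exact e1.symm

end perms

/-- flagged flattened word -/
noncomputable def fl {n : ℕ} (π : Equiv.Perm (Fin n)) : List (ℕ × Bool) :=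
  (flat π).map (fun x : Fin n => ((x : ℕ) + 1, decide (x ∈ cycleMins π)))

lemma flattenPerm_eq {n : ℕ} (π : Equiv.Perm (Fin n)) :
    flattenPerm π = (flat π).map (fun x : Fin n => (x : ℕ) + 1) := by
  have h : ∀ l : List (Fin n), (List.map (fun m => m + 1) (do let a ← l; pure (a : ℕ)))
      = l.map (fun x : Fin n => (x : ℕ) + 1) := by
    intro l
    induction l with
    | nil => rfl
    | cons a l ih => simpa using ih
  exact h _

lemma fl_fst {n : ℕ} (π : Equiv.Perm (Fin n)) : (fl π).map Prod.fst = flattenPerm π := by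
  rw [flattenPerm_eq]
  unfold fl
  rw [List.map_map]
  rfl

lemma fl_inj {n : ℕ} : Function.Injective (fl (n := n)) := by
  intro π σ h
  have h1 : flat π = flat σ := by
    have := congrArg (List.map Prod.fst) h
    unfold fl at this
    rw [List.map_map, List.map_map] at this
    refine List.map_injective_iff.mpr ?_ this
    intro a b hab
    simp at hab
    exact Fin.ext hab
  apply perm_eq_of π σ h1
  intro x
  unfold fl at h
  rw [h1, List.map_inj_left] at h
  have := h x (mem_flat σ x)
  simpa using this

lemma fl_cons {m : ℕ} (π : Equiv.Perm (Fin (m + 1))) : ∃ t, fl π = (1, true) :: t := by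
  have hp := flat_pairwise π
  have h0 := mem_flat π 0
  have hz : (0 : Fin (m + 1)) ∈ cycleMins π := (mem_cycleMins π 0).mpr (fun k => Fin.zero_le _)
  have hd : ∀ a t, flat π = a :: t → a ∈ cycleMins π := by
    intro a t h
    have hs := blocks_spec π
    unfold flat at h
    rcases hB : (cycleMins π).map (cycleList π) with _ | ⟨l, B⟩
    · rw [hB] at h
      simp at h
    · rw [hB] at h hs
      obtain ⟨b, s, rfl, hb, _⟩ := hs l (by simp)
      simp at h
      exact h.1 ▸ hb
  rcases hf : flat π with _ | ⟨a, t⟩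
  · rw [hf] at h0
    simp at h0
  · have ha := hd a t hf
    rw [hf] at h0 hp
    rw [List.pairwise_cons] at hp
    have : a = 0 := by
      rw [List.mem_cons] at h0
      rcases h0 with h | h
      · exact h.symm
      · have := (hp.1 0 h).2 ha
        simp at this
    subst this
    unfold fl
    rw [hf]
    simp [hz]

lemma fl_tail_mem {m : ℕ} (π : Equiv.Perm (Fin (m + 1))) :
    (fl π).tail ∈ cw m (Finset.Icc 2 (m + 1)) := by
  have hp := flat_pairwise π
  have hn : (flat π).Nodup := hp.imp (fun h => h.1)
  have hlen : (flat π).length = m + 1 := by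
    rw [← List.toFinset_card_of_nodup hn]
    have : (flat π).toFinset = Finset.univ := by
      ext x
      simp [mem_flat]
    rw [this]
    simp
  have hlen' : (fl π).length = m + 1 := by
    unfold fl
    rw [List.length_map, hlen]
  have hnd : ((fl π).map Prod.fst).Nodup := by
    rw [fl_fst, flattenPerm_eq]
    apply hn.map
    intro a b hab
    simp at hab
    exact Fin.ext hab
  have hset : ((fl π).map Prod.fst).toFinset = Finset.Icc 1 (m + 1) := by
    ext z
    rw [fl_fst, flattenPerm_eq, List.mem_toFinset, List.mem_map, Finset.mem_Icc]
    constructor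
    · rintro ⟨x, _, rfl⟩
      have := x.2
      omega
    · rintro ⟨h1, h2⟩
      exact ⟨⟨z - 1, by omega⟩, mem_flat π _, by simp; omega⟩
  have hpw : (fl π).Pairwise (fun a b => a.2 = true → a.1 < b.1) := by
    unfold fl
    rw [List.pairwise_map]
    refine hp.imp ?_
    intro a b h h'
    have := h.2 (by simpa using h')
    simpa using this
  obtain ⟨t, ht⟩ := fl_cons π
  rw [ht] at hlen' hnd hset hpw ⊢
  simp only [List.map_cons, List.nodup_cons, List.toFinset_cons, List.pairwise_cons,
        List.length_cons, List.tail_cons] at *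
  apply mem_cw m _ _ (by omega) hnd.2 _ hpw.2
  have h1 : 1 ∉ (t.map Prod.fst).toFinset := by
    rw [List.mem_toFinset]
    exact hnd.1
  rw [← Finset.erase_insert h1, hset]
  ext z
  simp only [Finset.mem_erase, Finset.mem_Icc]
  omega

lemma gPoly_eq (m : ℕ) : (gPoly (m + 1)).map (Int.castRingHom ℚ) = FF (X : ℚ[X]) m 0 := by
  have hc : (Finset.Icc 2 (m + 1)).card = m := by simp
  have hs := cw_sum (X : ℚ[X]) m (Finset.Icc 2 (m + 1)) hc 1 (by simp)
  have hr : rk (Finset.Icc 2 (m + 1)) 1 = 0 := by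
    rw [rk_zero_iff]
    intro s hs
    rw [Finset.mem_Icc] at hs
    omega
  rw [hr] at hs
  rw [← hs]
  have hinj : Set.InjOn (fun π : Equiv.Perm (Fin (m + 1)) => (fl π).tail)
      (Finset.univ : Finset (Equiv.Perm (Fin (m + 1)))) := by
    intro π _ σ _ h
    apply fl_inj
    obtain ⟨t, ht⟩ := fl_cons π
    obtain ⟨s, hs⟩ := fl_cons σ
    simp only [ht, hs, List.tail_cons] at h
    rw [ht, hs, h]
  have him : (Finset.univ : Finset (Equiv.Perm (Fin (m + 1)))).image (fun π => (fl π).tail)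
      = cw m (Finset.Icc 2 (m + 1)) := by
    apply Finset.eq_of_subset_of_card_le
    · intro l hl
      rw [Finset.mem_image] at hl
      obtain ⟨π, _, rfl⟩ := hl
      exact fl_tail_mem π
    · rw [Finset.card_image_of_injOn hinj, cw_card m _ hc, Finset.card_univ, Fintype.card_perm,
        Fintype.card_fin]
  rw [← him, Finset.sum_image hinj]
  unfold gPoly
  rw [Polynomial.map_sum]
  apply Finset.sum_congr rfl
  intro π _
  obtain ⟨t, ht⟩ := fl_cons π
  rw [Polynomial.map_pow, Polynomial.map_X, ← fl_fst, ht, List.map_cons, occ_eq_wt, List.tail_cons]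

/-- For every `n ≥ 2`, `g_n = Σ_{j=1}^{n-1} b_{n,j}·(q−1)^{j-1}·g_{n-j}`. -/
theorem gPoly_recurrence (n : ℕ) (hn : 2 ≤ n) :
    (gPoly n).map (Int.castRingHom ℚ)
      = ∑ j ∈ Finset.Icc 1 (n - 1),
          bPoly n j * (X - 1) ^ (j - 1) * (gPoly (n - j)).map (Int.castRingHom ℚ) := by
  obtain ⟨m, rfl⟩ := Nat.exists_eq_add_of_le' (show 1 ≤ n by omega)
  rw [gPoly_eq, FF_recurrence m (by omega), Nat.add_sub_cancel, Finset.range_eq_Ico,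
    Finset.sum_Ico_eq_sum_range, ← Finset.Ico_add_one_right_eq_Icc, Finset.sum_Ico_eq_sum_range]
  apply Finset.sum_congr (by simp)
  intro j hj
  rw [Finset.mem_range] at hj
  rw [show m + 1 - (1 + j) = (m - 1 - j) + 1 by omega, gPoly_eq, zero_add,
    show 1 + j = j + 1 by ring, Nat.add_sub_cancel]
end

section
/- For every integer n ≥ 1, the average number of occurrences of the pattern 13-2 in Flatten(π) over all n! permutations π of length n equals (n² + 3n + 8)/12 − H_n, where H_n = Σ_{k=1}^n 1/k is the n-th harmonic number; equivalently, Σ_{π ∈ S_n} occ(Flatten(π)) = n!·((n² + 3n + 8)/12 − H_n). -/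
open Finset Polynomial

namespace Flat

/-! ### Statistics on lists -/

def occR : List ℕ → ℕ
  | [] => 0
  | [_] => 0
  | a :: b :: t => t.countP (fun x => decide (a < x ∧ x < b)) + occR (b :: t)

def noninv : List ℕ → ℕ
  | [] => 0
  | a :: t => t.countP (fun x => decide (a < x)) + noninv t

theorem countP_eq_sum (p : ℕ → Prop) [DecidablePred p] (t : List ℕ) :
    t.countP (fun x => decide (p x)) = ∑ j ∈ Finset.range t.length, if p (t.getD j 0) then 1 else 0 := by
  induction t with
  | nil => simp
  | cons a t ih =>
    rw [List.countP_cons, List.length_cons, Finset.sum_range_succ', ih]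
    simp

theorem occ_eq_sum (w : List ℕ) : occ w = ∑ i ∈ Finset.range w.length, ∑ j ∈ Finset.range w.length,
    if (1 ≤ i ∧ i < j ∧ w.getD (i - 1) 0 < w.getD j 0 ∧ w.getD j 0 < w.getD i 0) then 1 else 0 := by
  unfold occ
  rw [Finset.card_filter, Finset.sum_product]

theorem occ_eq_occR (w : List ℕ) : occ w = occR w := by
  induction w with
  | nil => simp [occ, occR]
  | cons a w ih =>
    cases w with
    | nil => simp [occ_eq_sum, occR]
    | cons b t =>
      have key : occ (a :: b :: t) = t.countP (fun x => decide (a < x ∧ x < b)) + occ (b :: t) := by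
        rw [countP_eq_sum, occ_eq_sum, occ_eq_sum]
        simp only [List.length_cons]
        rw [Finset.sum_range_succ', Finset.sum_range_succ', Finset.sum_range_succ' _ t.length]
        simp [Finset.sum_range_succ' _ (t.length+1), Finset.sum_range_succ' _ (t.length)]
        ring
      rw [key, ih, occR]

def insAll (N : ℕ) : List ℕ → List (List ℕ)
  | [] => []
  | a :: t => (a :: N :: t) :: (insAll N t).map (a :: ·)

theorem length_insAll (N : ℕ) (w : List ℕ) : (insAll N w).length = w.length := by
  induction w with
  | nil => rfl
  | cons a t ih => simp [insAll, ih]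

theorem insAll_perm (N : ℕ) (w v : List ℕ) (h : v ∈ insAll N w) : v.Perm (N :: w) := by
  induction w generalizing v with
  | nil => simp [insAll] at h
  | cons a t ih =>
    simp only [insAll, List.mem_cons, List.mem_map] at h
    rcases h with rfl | ⟨u, hu, rfl⟩
    · exact List.Perm.swap _ _ _
    · exact ((ih u hu).cons a).trans (List.Perm.swap _ _ _)

theorem insAll_head (N b : ℕ) (s v : List ℕ) (h : v ∈ insAll N (b :: s)) :
    ∃ r, v = b :: r ∧ r.Perm (N :: s) := by
  have hp := insAll_perm _ _ _ h
  simp only [insAll, List.mem_cons, List.mem_map] at h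
  rcases h with rfl | ⟨u, hu, rfl⟩
  · exact ⟨_, rfl, List.Perm.refl _⟩
  · exact ⟨_, rfl, insAll_perm _ _ _ hu⟩

theorem occR_cons_big (N : ℕ) (t : List ℕ) (h : ∀ x ∈ t, x < N) : occR (N :: t) = occR t := by
  cases t with
  | nil => rfl
  | cons b s =>
    have : s.countP (fun x => decide (N < x ∧ x < b)) = 0 := by
      rw [List.countP_eq_zero]
      intro x hx
      have := h x (by simp [hx])
      simp; omega
    rw [occR, this, zero_add]

theorem noninv_cons_big (N : ℕ) (t : List ℕ) (h : ∀ x ∈ t, x < N) : noninv (N :: t) = noninv t := by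
  have : t.countP (fun x => decide (N < x)) = 0 := by
    rw [List.countP_eq_zero]
    intro x hx
    have := h x hx
    simp; omega
  rw [noninv, this, zero_add]

theorem sum_map_const_add (L : List (List ℕ)) (f g : List ℕ → ℕ) (c : ℕ)
    (h : ∀ v ∈ L, f v = c + g v) : (L.map f).sum = L.length * c + (L.map g).sum := by
  induction L with
  | nil => simp
  | cons v L ih =>
    simp only [List.map_cons, List.sum_cons, List.length_cons]
    rw [h v (by simp), ih (fun u hu => h u (by simp [hu]))]
    ring

theorem sum_occR (N : ℕ) (w : List ℕ) (h : ∀ x ∈ w, x < N) :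
    ((insAll N w).map occR).sum + occR w = w.length * occR w + noninv w := by
  induction w with
  | nil => simp [insAll, occR, noninv]
  | cons a t ih =>
    have ht : ∀ x ∈ t, x < N := fun x hx => h x (by simp [hx])
    have ih := ih ht
    obtain ⟨c, hc1, hc2⟩ : ∃ c, occR (a :: t) = c + occR t ∧
        ∀ v ∈ insAll N t, occR (a :: v) = c + occR v := by
      cases t with
      | nil => exact ⟨0, by simp [occR], by simp [insAll]⟩
      | cons b s =>
        refine ⟨_, rfl, ?_⟩
        intro v hv
        obtain ⟨r, rfl, hr⟩ := insAll_head _ _ _ _ hv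
        have hb := ht b (by simp)
        rw [occR, hr.countP_eq, List.countP_cons]
        have : ¬ (a < N ∧ N < b) := by omega
        simp [this]
    have h1 : occR (a :: N :: t) = t.countP (fun x => decide (a < x)) + occR t := by
      rw [occR, occR_cons_big N t ht]
      congr 1
      apply List.countP_congr
      intro x hx
      have := ht x hx
      simp [this]
    simp only [insAll, List.map_cons, List.sum_cons, List.map_map, noninv, List.length_cons]
    rw [sum_map_const_add (insAll N t) (occR ∘ (a :: ·)) occR c hc2, h1, hc1, length_insAll]
    nlinarith

theorem sum_noninv (N : ℕ) (w : List ℕ) (h : ∀ x ∈ w, x < N) :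
    2 * ((insAll N w).map noninv).sum = 2 * (w.length * noninv w) + w.length * (w.length + 1) := by
  induction w with
  | nil => simp [insAll]
  | cons a t ih =>
    have ht : ∀ x ∈ t, x < N := fun x hx => h x (by simp [hx])
    have ha : a < N := h a (by simp)
    have ih := ih ht
    have hc2 : ∀ v ∈ insAll N t, noninv (a :: v) = (t.countP (fun x => decide (a < x)) + 1) + noninv v := by
      intro v hv
      rw [noninv, (insAll_perm _ _ _ hv).countP_eq, List.countP_cons]
      simp [ha]
    have h1 : noninv (a :: N :: t) = t.countP (fun x => decide (a < x)) + 1 + noninv t := by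
      rw [noninv, noninv_cons_big N t ht, List.countP_cons]
      simp [ha]
    simp only [insAll, List.map_cons, List.sum_cons, List.map_map, noninv, List.length_cons]
    rw [sum_map_const_add (insAll N t) (noninv ∘ (a :: ·)) noninv _ hc2, length_insAll]
    simp only [noninv] at h1
    rw [h1]
    nlinarith

theorem occR_append (N : ℕ) (w : List ℕ) (h : ∀ x ∈ w, x < N) : occR (w ++ [N]) = occR w := by
  induction w with
  | nil => rfl
  | cons a t ih =>
    cases t with
    | nil => simp [occR]
    | cons b s =>
      have := ih (fun x hx => h x (by simp [hx]))
      have hb := h b (by simp)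
      simp only [List.cons_append] at this ⊢
      rw [occR, this, occR, List.countP_append]
      have : ¬ (a < N ∧ N < b) := by omega
      simp [this]

theorem noninv_append (N : ℕ) (w : List ℕ) (h : ∀ x ∈ w, x < N) :
    noninv (w ++ [N]) = noninv w + w.length := by
  induction w with
  | nil => rfl
  | cons a t ih =>
    have := ih (fun x hx => h x (by simp [hx]))
    have ha := h a (by simp)
    simp only [List.cons_append, List.length_cons]
    rw [noninv, this, noninv, List.countP_append]
    simp [ha]
    ring

def ins (N p : ℕ) (w : List ℕ) : List ℕ := w.flatMap (fun x => if x = p then [x, N] else [x])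

theorem ins_not_mem (N p : ℕ) (w : List ℕ) (h : p ∉ w) : ins N p w = w := by
  induction w with
  | nil => rfl
  | cons a t ih =>
    simp only [List.mem_cons, not_or] at h
    have := ih h.2
    simp only [ins] at this
    simp [ins, this, Ne.symm h.1]

theorem map_ins (N : ℕ) (w : List ℕ) (h : w.Nodup) : w.map (fun p => ins N p w) = insAll N w := by
  induction w with
  | nil => rfl
  | cons a t ih =>
    rw [List.nodup_cons] at h
    simp only [List.map_cons, insAll]
    rw [← ih h.2]
    congr 1
    · have := ins_not_mem N a t h.1
      simp only [ins] at this
      simp [ins, this]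
    · rw [List.map_map]
      apply List.map_congr_left
      intro p hp
      have : a ≠ p := by rintro rfl; exact h.1 hp
      simp [ins, this]

/-! ### Cycles -/

def Path {α : Type*} (f : α → α) : α → List α → α → Prop
  | a, [], b => a = b
  | a, x :: L, b => a = x ∧ Path f (f x) L b

theorem path_iff {n : ℕ} (π : Equiv.Perm (Fin n)) (L : List (Fin n)) (a b : Fin n) :
    Path π a L b ↔ L = (List.range L.length).map (fun k => (π ^ k) a) ∧ (π ^ L.length) a = b := by
  induction L generalizing a with
  | nil => simp [Path]
  | cons x L ih =>
    simp only [Path, ih, List.length_cons, List.range_succ_eq_map, List.map_cons, List.map_map,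
      List.cons.injEq]
    constructor
    · rintro ⟨rfl, h1, h2⟩
      refine ⟨⟨by simp, ?_⟩, by simpa [pow_succ] using h2⟩
      conv_lhs => rw [h1]
      apply List.map_congr_left
      intro k hk
      simp [pow_succ]
    · rintro ⟨⟨h0, h1⟩, h2⟩
      simp at h0
      subst h0
      refine ⟨rfl, ?_, by simpa [pow_succ] using h2⟩
      conv_lhs => rw [h1]
      apply List.map_congr_left
      intro k hk
      simp [pow_succ]

theorem isPeriodic {n : ℕ} (π : Equiv.Perm (Fin n)) (m : Fin n) : m ∈ Function.periodicPts π :=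
  ⟨orderOf π, orderOf_pos π, by
    rw [Function.IsPeriodicPt, Function.IsFixedPt, ← Equiv.Perm.coe_pow, pow_orderOf_eq_one]; rfl⟩

theorem minPer_pos {n : ℕ} (π : Equiv.Perm (Fin n)) (m : Fin n) : 0 < Function.minimalPeriod π m :=
  Function.minimalPeriod_pos_of_mem_periodicPts (isPeriodic π m)

theorem cycleList_path {n : ℕ} (π : Equiv.Perm (Fin n)) (m : Fin n) : Path π m (cycleList π m) m := by
  rw [path_iff]
  refine ⟨by simp [cycleList], ?_⟩
  simp only [cycleList, List.length_map, List.length_range]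
  rw [Equiv.Perm.coe_pow]
  exact Function.iterate_minimalPeriod

theorem cycleList_ne {n : ℕ} (π : Equiv.Perm (Fin n)) (m : Fin n) : cycleList π m ≠ [] := by
  have := minPer_pos π m
  simp [cycleList]; omega

theorem cycleList_nodup {n : ℕ} (π : Equiv.Perm (Fin n)) (m : Fin n) : (cycleList π m).Nodup := by
  unfold cycleList
  refine List.Nodup.map_on ?_ List.nodup_range
  intro x hx y hy hxy
  simp only [List.mem_range] at hx hy
  rw [Equiv.Perm.coe_pow, Equiv.Perm.coe_pow] at hxy
  exact (Function.iterate_injOn_Iio_minimalPeriod) hx hy hxy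

theorem cycleList_unique {n : ℕ} (π : Equiv.Perm (Fin n)) (m : Fin n) (L : List (Fin n))
    (h : Path π m L m) (hne : L ≠ []) (hnd : L.Nodup) : L = cycleList π m := by
  rw [path_iff] at h
  have hlen : L.length = Function.minimalPeriod π m := by
    have hpos : 0 < L.length := List.length_pos_iff.mpr hne
    have hp : Function.IsPeriodicPt π L.length m := by
      have := h.2; rw [Equiv.Perm.coe_pow] at this; exact this
    refine le_antisymm ?_ (hp.minimalPeriod_le hpos)
    by_contra hlt
    push Not at hlt
    rw [h.1] at hnd
    have := List.inj_on_of_nodup_map hnd (x := 0) (y := Function.minimalPeriod π m)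
      (by simpa using hpos) (by simpa using hlt) (by
        rw [Equiv.Perm.coe_pow, Equiv.Perm.coe_pow, Function.iterate_minimalPeriod]; rfl)
    have := minPer_pos π m
    omega
  rw [h.1, hlen]; rfl

theorem mem_cycleList {n : ℕ} (π : Equiv.Perm (Fin n)) (m : Fin n) (k : ℕ) :
    (π ^ k) m ∈ cycleList π m := by
  simp only [cycleList, List.mem_map, List.mem_range]
  refine ⟨k % Function.minimalPeriod π m, Nat.mod_lt _ (minPer_pos π m), ?_⟩
  rw [Equiv.Perm.coe_pow, Equiv.Perm.coe_pow, Function.iterate_mod_minimalPeriod_eq]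

theorem min_iff {n : ℕ} (π : Equiv.Perm (Fin n)) (m : Fin n) :
    (∀ k < n, m ≤ (π ^ k) m) ↔ ∀ x ∈ cycleList π m, m ≤ x := by
  constructor
  · intro h x hx
    have hl : (cycleList π m).length ≤ n := by
      simpa using (cycleList_nodup π m).length_le_card
    simp only [cycleList, List.length_map, List.length_range, List.mem_map, List.mem_range] at hx hl
    obtain ⟨k, hk, rfl⟩ := hx
    exact h k (by omega)
  · intro h k _
    exact h _ (mem_cycleList π m k)

/-! ### The insertion bijection -/

def ext {n : ℕ} (π : Equiv.Perm (Fin n)) : Equiv.Perm (Fin (n + 1)) where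
  toFun := Fin.lastCases (Fin.last n) (fun i => (π i).castSucc)
  invFun := Fin.lastCases (Fin.last n) (fun i => (π.symm i).castSucc)
  left_inv x := by induction x using Fin.lastCases <;> simp
  right_inv x := by induction x using Fin.lastCases <;> simp

@[simp] theorem ext_last {n : ℕ} (π : Equiv.Perm (Fin n)) : ext π (Fin.last n) = Fin.last n := by
  simp [ext]

@[simp] theorem ext_cast {n : ℕ} (π : Equiv.Perm (Fin n)) (i : Fin n) :
    ext π i.castSucc = (π i).castSucc := by
  simp [ext]

def Phi {n : ℕ} (x : Equiv.Perm (Fin n) × Fin (n + 1)) : Equiv.Perm (Fin (n + 1)) :=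
  ext x.1 * Equiv.swap x.2 (Fin.last n)

theorem Phi_p {n : ℕ} (π : Equiv.Perm (Fin n)) (p : Fin (n + 1)) : Phi (π, p) p = Fin.last n := by
  simp [Phi]

theorem Phi_cast_last {n : ℕ} (π : Equiv.Perm (Fin n)) (p : Fin n) :
    Phi (π, p.castSucc) (Fin.last n) = (π p).castSucc := by
  simp [Phi]

theorem Phi_other {n : ℕ} (π : Equiv.Perm (Fin n)) (p : Fin (n + 1)) (x : Fin n) (h : x.castSucc ≠ p) :
    Phi (π, p) x.castSucc = (π x).castSucc := by
  simp only [Phi, Equiv.Perm.mul_apply]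
  rw [Equiv.swap_apply_of_ne_of_ne h (Fin.castSucc_lt_last x).ne, ext_cast]

theorem Phi_bij (n : ℕ) : Function.Bijective (Phi (n := n)) := by
  rw [Fintype.bijective_iff_injective_and_card]
  constructor
  · rintro ⟨π, p⟩ ⟨ρ, q⟩ h
    have hpq : p = q := by
      apply (Phi (π, p)).injective
      rw [Phi_p, h, Phi_p]
    subst hpq
    simp only [Phi, mul_left_inj] at h
    congr 1
    ext i
    have := congrArg (fun f => f i.castSucc) h
    simp only [ext_cast] at this
    exact congrArg Fin.val (Fin.castSucc_injective _ this)
  · simp [Fintype.card_perm, Nat.factorial_succ, mul_comm]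

def insF {n : ℕ} (p : Fin (n + 1)) (x : Fin n) : List (Fin (n + 1)) :=
  if x.castSucc = p then [x.castSucc, Fin.last n] else [x.castSucc]

theorem path_ins {n : ℕ} (π : Equiv.Perm (Fin n)) (p : Fin (n + 1)) (L : List (Fin n)) (a b : Fin n)
    (h : Path π a L b) : Path (Phi (π, p)) a.castSucc (L.flatMap (insF p)) b.castSucc := by
  induction L generalizing a with
  | nil => simpa [Path] using h
  | cons x L ih =>
    obtain ⟨rfl, h⟩ := h
    have := ih _ h
    rw [List.flatMap_cons, insF]
    split_ifs with hx
    · subst hx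
      refine ⟨rfl, ?_, ?_⟩
      · rw [Phi_p]
      · rw [Phi_cast_last]; exact this
    · refine ⟨rfl, ?_⟩
      rw [Phi_other π p a hx]; exact this

theorem mem_insF {n : ℕ} (p : Fin (n + 1)) (x : Fin n) (y : Fin (n + 1)) :
    y ∈ insF p x ↔ y = x.castSucc ∨ (x.castSucc = p ∧ y = Fin.last n) := by
  unfold insF; split_ifs with h <;> simp [h]

theorem nodup_ins {n : ℕ} (p : Fin (n + 1)) (L : List (Fin n)) (h : L.Nodup) :
    (L.flatMap (insF p)).Nodup := by
  rw [List.nodup_flatMap]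
  constructor
  · intro x _
    unfold insF
    split_ifs <;> simp [(Fin.castSucc_lt_last x).ne]
  · refine List.Pairwise.imp ?_ h
    intro x y hxy z hz1 hz2
    rw [mem_insF] at hz1 hz2
    have h1 := (Fin.castSucc_lt_last x).ne
    have h2 := (Fin.castSucc_lt_last y).ne
    have h3 : x.castSucc ≠ y.castSucc := fun h => hxy (Fin.castSucc_injective _ h)
    grind

theorem cycleList_Phi {n : ℕ} (π : Equiv.Perm (Fin n)) (p : Fin (n + 1)) (m : Fin n) :
    cycleList (Phi (π, p)) m.castSucc = (cycleList π m).flatMap (insF p) := by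
  symm
  apply cycleList_unique
  · exact path_ins _ _ _ _ _ (cycleList_path π m)
  · have := cycleList_ne π m
    intro h
    rw [List.flatMap_eq_nil_iff] at h
    obtain ⟨x, hx⟩ := List.exists_mem_of_ne_nil _ this
    have := h x hx
    unfold insF at this
    split_ifs at this
  · exact nodup_ins _ _ (cycleList_nodup π m)

theorem cycleList_last {n : ℕ} (π : Equiv.Perm (Fin n)) :
    cycleList (Phi (π, Fin.last n)) (Fin.last n) = [Fin.last n] := by
  symm
  apply cycleList_unique
  · exact ⟨rfl, Phi_p _ _⟩
  · simp
  · simp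

theorem mem_cycleMins {n : ℕ} (π : Equiv.Perm (Fin n)) (m : Fin n) :
    m ∈ cycleMins π ↔ ∀ x ∈ cycleList π m, m ≤ x := by
  rw [← min_iff]; simp [cycleMins]

theorem cycleMins_unique {n : ℕ} (π : Equiv.Perm (Fin n)) (L : List (Fin n))
    (hs : L.Pairwise (· ≤ ·)) (hn : L.Nodup) (h : ∀ m, m ∈ L ↔ ∀ x ∈ cycleList π m, m ≤ x) :
    cycleMins π = L := by
  rw [← (List.toFinset_sort (· ≤ ·) hn).2 hs]
  unfold cycleMins
  congr 1
  ext m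
  rw [List.mem_toFinset, h, ← min_iff]
  simp

theorem cycleMins_sorted {n : ℕ} (π : Equiv.Perm (Fin n)) : (cycleMins π).Pairwise (· ≤ ·) :=
  Finset.pairwise_sort _ _

theorem cycleMins_nodup {n : ℕ} (π : Equiv.Perm (Fin n)) : (cycleMins π).Nodup :=
  Finset.sort_nodup _ _

theorem cast_min {n : ℕ} (π : Equiv.Perm (Fin n)) (p : Fin (n + 1)) (m : Fin n) :
    (∀ x ∈ cycleList (Phi (π, p)) m.castSucc, m.castSucc ≤ x) ↔ ∀ x ∈ cycleList π m, m ≤ x := by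
  rw [cycleList_Phi]
  constructor
  · intro h x hx
    have := h x.castSucc (by rw [List.mem_flatMap]; exact ⟨x, hx, by simp [mem_insF]⟩)
    simpa using this
  · intro h y hy
    rw [List.mem_flatMap] at hy
    obtain ⟨x, hx, hy⟩ := hy
    rw [mem_insF] at hy
    rcases hy with rfl | ⟨_, rfl⟩
    · simpa using h x hx
    · exact Fin.le_last _

theorem cycleMins_cast {n : ℕ} (π : Equiv.Perm (Fin n)) (p : Fin n) :
    cycleMins (Phi (π, p.castSucc)) = (cycleMins π).map Fin.castSucc := by
  apply cycleMins_unique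
  · rw [List.pairwise_map]
    exact (cycleMins_sorted π).imp (by intro a b h; simpa using h)
  · exact (cycleMins_nodup π).map (Fin.castSucc_injective _)
  · intro m
    induction m using Fin.lastCases with
    | last =>
      constructor
      · intro h
        rw [List.mem_map] at h
        obtain ⟨a, _, ha⟩ := h
        exact absurd ha (Fin.castSucc_lt_last a).ne
      · intro h
        have := h _ (mem_cycleList _ _ 1)
        rw [pow_one, Phi_cast_last] at this
        exact absurd (Fin.castSucc_lt_last (π p)) (not_lt.mpr this)
    | cast m =>
      rw [cast_min, ← mem_cycleMins, List.mem_map_of_injective (Fin.castSucc_injective _)]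

theorem cycleMins_last {n : ℕ} (π : Equiv.Perm (Fin n)) :
    cycleMins (Phi (π, Fin.last n)) = (cycleMins π).map Fin.castSucc ++ [Fin.last n] := by
  apply cycleMins_unique
  · rw [List.pairwise_append, List.pairwise_map]
    refine ⟨(cycleMins_sorted π).imp (by intro a b h; simpa using h), by simp, ?_⟩
    intro a _ b hb
    simp only [List.mem_singleton] at hb
    subst hb
    exact Fin.le_last _
  · rw [List.nodup_append]
    refine ⟨(cycleMins_nodup π).map (Fin.castSucc_injective _), by simp, ?_⟩
    intro a ha b hb
    simp only [List.mem_singleton] at hb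
    rw [List.mem_map] at ha
    obtain ⟨a, _, rfl⟩ := ha
    subst hb
    exact (Fin.castSucc_lt_last a).ne
  · intro m
    induction m using Fin.lastCases with
    | last => rw [cycleList_last]; simp
    | cast m =>
      rw [cast_min, ← mem_cycleMins, List.mem_append,
        List.mem_map_of_injective (Fin.castSucc_injective _)]
      simp [(Fin.castSucc_lt_last m).ne]

theorem flatMap_flatten {α β : Type*} (f : α → List β) (L : List (List α)) :
    L.flatten.flatMap f = (L.map (fun l => l.flatMap f)).flatten := by
  induction L with
  | nil => rfl
  | cons a L ih => simp [List.flatMap_append, ih]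

theorem val_insF {n : ℕ} (p : Fin n) (L : List (Fin n)) :
    (L.flatMap (insF p.castSucc)).map (fun m : Fin _ => (m : ℕ) + 1)
      = ins (n + 1) (p + 1) (L.map (fun m : Fin _ => (m : ℕ) + 1)) := by
  induction L with
  | nil => rfl
  | cons a L ih =>
    simp only [ins, List.map_cons, List.flatMap_cons, List.map_append] at ih ⊢
    rw [ih]
    congr 1
    by_cases h : a = p
    · simp [insF, h]
    · have : (a : ℕ) ≠ p := fun h' => h (Fin.ext h')
      simp [insF, h, this]

theorem val_insF_last {n : ℕ} (L : List (Fin n)) :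
    (L.flatMap (insF (Fin.last n))).map (fun m : Fin _ => (m : ℕ) + 1) = L.map (fun m : Fin _ => (m : ℕ) + 1) := by
  induction L with
  | nil => rfl
  | cons a L ih =>
    simp only [List.map_cons, List.flatMap_cons, List.map_append] at ih ⊢
    rw [ih]
    simp [insF, (Fin.castSucc_lt_last a).ne]

theorem flattenPerm_eq {n : ℕ} (π : Equiv.Perm (Fin n)) : flattenPerm π =
    ((cycleMins π).map (cycleList π)).flatten.map (fun m : Fin n => (m : ℕ) + 1) := by
  unfold flattenPerm
  generalize ((cycleMins π).map (cycleList π)).flatten = L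
  induction L with
  | nil => rfl
  | cons a L ih => simp_all

theorem flatten_cast {n : ℕ} (π : Equiv.Perm (Fin n)) (p : Fin n) :
    flattenPerm (Phi (π, p.castSucc)) = ins (n + 1) (p + 1) (flattenPerm π) := by
  rw [flattenPerm_eq, flattenPerm_eq, ← val_insF, cycleMins_cast, flatMap_flatten, List.map_map, List.map_map]
  congr 2
  exact List.map_congr_left (fun m _ => cycleList_Phi _ _ _)

theorem flatten_last {n : ℕ} (π : Equiv.Perm (Fin n)) :
    flattenPerm (Phi (π, Fin.last n)) = flattenPerm π ++ [n + 1] := by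
  rw [flattenPerm_eq, flattenPerm_eq π, ← val_insF_last (n := n) (List.flatten _), cycleMins_last, flatMap_flatten, List.map_append, List.flatten_append,
    List.map_append, List.map_map, List.map_map]
  congr 1
  · congr 2
    exact List.map_congr_left (fun m _ => cycleList_Phi _ _ _)
  · simp [cycleList_last]

theorem flatten_perm {n : ℕ} (π : Equiv.Perm (Fin n)) :
    (flattenPerm π).Perm ((List.finRange n).map (fun m : Fin _ => (m : ℕ) + 1)) := by
  induction n with
  | zero =>
    have : cycleMins π = [] := List.eq_nil_iff_forall_not_mem.mpr (fun a => a.elim0)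
    simp [flattenPerm, this]
  | succ n ih =>
    obtain ⟨⟨ρ, p⟩, rfl⟩ := (Phi_bij n).2 π
    have hR : ((List.finRange (n + 1)).map (fun m : Fin _ => (m : ℕ) + 1)).Perm
        ((n + 1) :: (List.finRange n).map (fun m : Fin _ => (m : ℕ) + 1)) := by
      rw [List.finRange_succ_last, List.map_append, List.map_map]
      exact List.perm_append_comm
    refine List.Perm.trans ?_ hR.symm
    refine List.Perm.trans ?_ ((ih ρ).cons (n + 1))
    induction p using Fin.lastCases with
    | last => rw [flatten_last]; exact List.perm_append_comm
    | cast p =>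
      rw [flatten_cast]
      have hnd : (flattenPerm ρ).Nodup := by
        rw [(ih ρ).nodup_iff]
        exact (List.nodup_finRange n).map (fun a b h => Fin.ext (by simpa using h))
      apply insAll_perm
      rw [← map_ins _ _ hnd, List.mem_map]
      refine ⟨p + 1, ?_, rfl⟩
      rw [(ih ρ).mem_iff, List.mem_map]
      exact ⟨p, List.mem_finRange _, rfl⟩

theorem flatten_nodup {n : ℕ} (π : Equiv.Perm (Fin n)) : (flattenPerm π).Nodup := by
  rw [(flatten_perm π).nodup_iff]
  exact (List.nodup_finRange n).map (fun a b h => Fin.ext (by simpa using h))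

theorem flatten_length {n : ℕ} (π : Equiv.Perm (Fin n)) : (flattenPerm π).length = n := by
  rw [(flatten_perm π).length_eq]; simp

theorem flatten_lt {n : ℕ} (π : Equiv.Perm (Fin n)) : ∀ x ∈ flattenPerm π, x < n + 1 := by
  intro x hx
  rw [(flatten_perm π).mem_iff, List.mem_map] at hx
  obtain ⟨m, _, rfl⟩ := hx
  omega

theorem sum_step (n : ℕ) (F : List ℕ → ℕ) :
    ∑ σ : Equiv.Perm (Fin (n + 1)), F (flattenPerm σ) =
      ∑ π : Equiv.Perm (Fin n),
        (((insAll (n + 1) (flattenPerm π)).map F).sum + F (flattenPerm π ++ [n + 1])) := by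
  rw [← (Phi_bij n).sum_comp (fun σ => F (flattenPerm σ)), Fintype.sum_prod_type]
  apply Finset.sum_congr rfl
  intro π _
  rw [Fin.sum_univ_castSucc, flatten_last]
  congr 1
  rw [← map_ins _ _ (flatten_nodup π), List.map_map,
    ((flatten_perm π).map _).sum_eq, List.map_map, ← List.sum_ofFn, List.ofFn_eq_map]
  simp only [flatten_cast]
  rfl

theorem occ_step (n : ℕ) :
    ∑ σ : Equiv.Perm (Fin (n + 1)), occR (flattenPerm σ) =
      n * ∑ π : Equiv.Perm (Fin n), occR (flattenPerm π) + ∑ π : Equiv.Perm (Fin n), noninv (flattenPerm π) := by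
  rw [sum_step, Finset.mul_sum, ← Finset.sum_add_distrib]
  apply Finset.sum_congr rfl
  intro π _
  rw [occR_append _ _ (flatten_lt π), sum_occR _ _ (flatten_lt π), flatten_length]

theorem noninv_step (n : ℕ) :
    2 * ∑ σ : Equiv.Perm (Fin (n + 1)), noninv (flattenPerm σ) =
      2 * (n + 1) * ∑ π : Equiv.Perm (Fin n), noninv (flattenPerm π) + n.factorial * (n * (n + 3)) := by
  have : n.factorial * (n * (n + 3)) = ∑ π : Equiv.Perm (Fin n), n * (n + 3) := by
    simp [Fintype.card_perm]
  rw [sum_step, this, Finset.mul_sum, Finset.mul_sum, ← Finset.sum_add_distrib]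
  apply Finset.sum_congr rfl
  intro π _
  rw [noninv_append _ _ (flatten_lt π), mul_add, sum_noninv _ _ (flatten_lt π), flatten_length]
  ring

theorem noninv_total (n : ℕ) :
    ((∑ π : Equiv.Perm (Fin n), noninv (flattenPerm π) : ℕ) : ℚ) =
      (n.factorial : ℚ) * (((n : ℚ) ^ 2 + 3 * n) / 4 - ∑ k ∈ Finset.Icc 1 n, (1 : ℚ) / k) := by
  induction n with
  | zero =>
    have h : ∀ π : Equiv.Perm (Fin 0), flattenPerm π = [] := fun π =>
      List.length_eq_zero_iff.mp (flatten_length π)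
    simp [h, noninv]
  | succ n ih =>
    have h := congrArg (Nat.cast (R := ℚ)) (noninv_step n)
    push_cast at h ih ⊢
    rw [ih] at h
    rw [Finset.sum_Icc_succ_top (by omega), Nat.factorial_succ]
    push_cast
    have hn : (n : ℚ) + 1 ≠ 0 := by positivity
    have h2 : ∀ x y : ℚ, 2 * x = y → x = y / 2 := by intro x y h; linarith
    rw [h2 _ _ h]
    field_simp
    ring

theorem occ_total (n : ℕ) :
    ((∑ π : Equiv.Perm (Fin (n + 1)), occR (flattenPerm π) : ℕ) : ℚ) =
      ((n + 1).factorial : ℚ) * ((((n + 1 : ℕ) : ℚ) ^ 2 + 3 * (n + 1 : ℕ) + 8) / 12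
        - ∑ k ∈ Finset.Icc 1 (n + 1), (1 : ℚ) / k) := by
  induction n with
  | zero =>
    rw [occ_step 0, zero_mul, zero_add, noninv_total]
    norm_num
  | succ n ih =>
    rw [occ_step, Nat.cast_add, Nat.cast_mul, ih, noninv_total,
      Finset.sum_Icc_succ_top (b := n + 1) (by omega), Nat.factorial_succ (n + 1)]
    have hn : (n : ℚ) + 1 + 1 ≠ 0 := by positivity
    push_cast
    field_simp
    ring

end Flat

/-- For every `n ≥ 1`,
`Σ_{π ∈ S_n} occ(Flatten(π)) = n!·((n² + 3n + 8)/12 − H_n)`. -/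
theorem average_occurrences (n : ℕ) (hn : 1 ≤ n) :
    (∑ π : Equiv.Perm (Fin n), (occ (flattenPerm π) : ℚ))
      = (n.factorial : ℚ) * (((n : ℚ) ^ 2 + 3 * n + 8) / 12 - ∑ k ∈ Finset.Icc 1 n, (1 : ℚ) / k) := by
  obtain ⟨m, rfl⟩ : ∃ m, n = m + 1 := ⟨n - 1, by omega⟩
  rw [← Flat.occ_total m]
  push_cast
  simp only [Flat.occ_eq_occR]
end
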